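/- For x, z ∈ P with x ≥ z, there exists a clean map *E_x → *E_z, and it is unique up to multiplication by a scalar in K. -/

import Mathlib

open scoped Classical
open MvPolynomial

noncomputable section

variable (K : Type) [Field K]
variable (P : Type) [Fintype P] [PartialOrder P] [OrderBot P]

/-- A finite poset with a least element is *simplicial* if every lower interval
is isomorphic to a boolean algebra (the lattice of all subsets of a finite set). -/
def IsSimplicialPoset : Prop :=
  ∀ x : P, ∃ m : ℕ, Nonempty (Set.Iic x ≃o Finset (Fin m))

/-- `P* := P \ {0̂}`. -/
abbrev Pstar := {z : P // z ≠ ⊥}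

/-- The polynomial ring `S = K[t_z : z ∈ P*]`. -/
abbrev FaceS := MvPolynomial (Pstar P) K

/-- The variable `t_z`, with the convention `t_{0̂} = 1`. -/
def tvar (z : P) : FaceS K P := if h : z = ⊥ then 1 else X ⟨z, h⟩

/-- The set `[a ∨ b]` of minimal elements of the common upper bounds of `a` and `b`. -/
def minUB (a b : P) : Set P :=
  {z | a ≤ z ∧ b ≤ z ∧ ∀ w, a ≤ w → b ≤ w → ¬ w < z}

/-- Minimal elements of the common upper bounds of a set `A`. -/
def minUBset (A : Set P) : Set P :=
  {z | (∀ a ∈ A, a ≤ z) ∧ ∀ w, (∀ a ∈ A, a ≤ w) → ¬ w < z}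

/-- The meet `a ∧ b`, i.e. the largest common lower bound, when it exists (`⊥` otherwise). -/
def pmeet (a b : P) : P :=
  if h : ∃ m, m ≤ a ∧ m ≤ b ∧ ∀ w, w ≤ a → w ≤ b → w ≤ m then h.choose else ⊥

/-- The generator `f_{a,b} = t_a t_b - t_{a ∧ b} ∑_{z ∈ [a ∨ b]} t_z` of the face ideal. -/
def fgen (a b : Pstar P) : FaceS K P :=
  X a * X b - tvar K P (pmeet P a.1 b.1) *
    ∑ z ∈ (Set.toFinite (minUB P a.1 b.1)).toFinset, tvar K P z

/-- The face ideal `I_P`. -/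
def faceIdeal : Ideal (FaceS K P) :=
  Ideal.span (Set.range fun p : Pstar P × Pstar P => fgen K P p.1 p.2)

variable (n : ℕ) (y : Fin n → P)

/-- `y` is an enumeration of the rank one elements (= atoms) of `P`. -/
def AtomEnum : Prop :=
  Function.Injective y ∧ ∀ p : P, IsAtom p ↔ ∃ i, y i = p

/-- The rank of an element: the number of atoms below it. -/
def prank (z : P) : ℕ := (Finset.univ.filter fun i : Fin n => y i ≤ z).card

/-- The `ℤⁿ`-degree of the variable `t_z`: `deg t_z = ∑_{y_i ≤ z} e_i`. -/
def tdeg (z : Pstar P) : Fin n → ℤ := fun i => if y i ≤ z.1 then 1 else 0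

/-- `w = ∑_{z ∈ P*} deg t_z`. -/
def wvec : Fin n → ℤ := fun i => ∑ z : Pstar P, tdeg P n y z i

/-- The degree `d` homogeneous component of `S` for the `ℤⁿ`-grading. -/
def Sgrade (d : Fin n → ℤ) : AddSubgroup (FaceS K P) :=
  (weightedHomogeneousSubmodule K (tdeg P n y) d).toAddSubgroup

/-- The transformed variable `t̃_z` (relative to `x`), with `t̃_{0̂} = 1`. -/
def ttil (x z : P) : FaceS K P :=
  if z ≤ x ∧ 2 ≤ prank P n y z then
    tvar K P z - ∏ i ∈ Finset.univ.filter fun i : Fin n => y i ≤ z, tvar K P (y i)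
  else tvar K P z

/-- The graded prime ideal `p_x = (t_z : z ≰ x) + I_P`. -/
def pIdeal (x : P) : Ideal (FaceS K P) :=
  Ideal.span ((fun z : Pstar P => (X z : FaceS K P)) '' {z | ¬ z.1 ≤ x}) ⊔ faceIdeal K P

/-- The indices of the atoms below `x`. -/
abbrev BelowIx (x : P) := {i : Fin n // y i ≤ x}

/-- `P*_{-x}`: the elements of `P*` which are not atoms below `x`. -/
abbrev Pmx (x : P) := {z : P // z ≠ ⊥ ∧ ¬ ∃ i : Fin n, y i ≤ x ∧ y i = z}

/-- Index monoid for the "big Laurent" model of `*E_x`. -/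
abbrev EIdx (x : P) := (BelowIx P n y x →₀ ℤ) × (Pmx P n y x →₀ ℤ)

/-- The "big Laurent" algebra `K[t_i^{±1} : y_i ≤ x] ⊗_K K[t̃_z^{±1} : z ∈ P*_{-x}]`. -/
abbrev Gx (x : P) := AddMonoidAlgebra K (EIdx P n y x)

/-- Exponent vector of `π_x(t_z) = ∏_{y_i ≤ z} t_i`. -/
def dvec (x : P) (z : P) : BelowIx P n y x →₀ ℤ :=
  Finsupp.equivFunOnFinite.symm fun i => if y i.1 ≤ z then 1 else 0

/-- The action of `S` on the big Laurent algebra through the comultiplication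
`Δ(t_z) = t_z ⊗ 1 + 1 ⊗ t_z`:  the variable `t_z` acts as `π_x(t_z) ⊗ 1 + 1 ⊗ t_z`. -/
def theta (x : P) : FaceS K P →ₐ[K] Gx K P n y x :=
  aeval fun z : Pstar P =>
    (if z.1 ≤ x then AddMonoidAlgebra.single (dvec P n y x z.1, 0) 1 else 0) +
    (if h : ∃ i : Fin n, y i ≤ x ∧ y i = z.1 then 0
     else AddMonoidAlgebra.single
       ((0 : BelowIx P n y x →₀ ℤ), Finsupp.single (⟨z.1, z.2, h⟩ : Pmx P n y x) (1 : ℤ)) 1)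

instance gxModule (x : P) : Module (FaceS K P) (Gx K P n y x) :=
  Module.compHom _ (theta K P n y x).toRingHom

instance gxTower (x : P) : IsScalarTower K (FaceS K P) (Gx K P n y x) := by
  refine ⟨fun k s g => ?_⟩
  show theta K P n y x (k • s) * g = k • (theta K P n y x s * g)
  rw [map_smul, smul_mul_assoc]

instance gxComm (x : P) : SMulCommClass (FaceS K P) K (Gx K P n y x) := by
  refine ⟨fun s k g => ?_⟩
  show theta K P n y x s * (k • g) = k • (theta K P n y x s * g)
  exact mul_smul_comm k _ g

/-- The submodule by which we quotient the big Laurent algebra to obtain `*E_x`. -/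
def Ux (x : P) : Submodule (FaceS K P) (Gx K P n y x) :=
  Submodule.span (FaceS K P)
    {g | ∃ p : EIdx P n y x, (∃ w, 0 < p.2 w) ∧ g = AddMonoidAlgebra.single p 1}

/-- The `ℤⁿ`-graded `S`-module `*E_x = K[t_i^{±1} : y_i ≤ x] ⊗_K K[t_z^{-1} : z ∈ P*_{-x}]`. -/
abbrev ExMod (x : P) := Gx K P n y x ⧸ Ux K P n y x

instance exComm (x : P) : SMulCommClass (FaceS K P) K (ExMod K P n y x) := by
  refine ⟨fun s k e => ?_⟩
  obtain ⟨g, rfl⟩ := Submodule.Quotient.mk_surjective _ e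
  simp only [← Submodule.Quotient.mk_smul]
  rw [smul_comm]

def mIdx (x : P) (a : BelowIx P n y x →₀ ℤ) (b : Pmx P n y x →₀ ℕ) : EIdx P n y x :=
  (a, -Finsupp.mapRange (Nat.cast : ℕ → ℤ) Nat.cast_zero b)

/-- The monomial `∏ t_i^{a_i} ⊗ ∏ t_z^{-b_z}` of `*E_x`. -/
def emono (x : P) (a : BelowIx P n y x →₀ ℤ) (b : Pmx P n y x →₀ ℕ) : ExMod K P n y x :=
  Submodule.Quotient.mk (AddMonoidAlgebra.single (mIdx P n y x a b) 1)

/-- `1_x = 1 ⊗ 1 ∈ *E_x`. -/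
def onex (x : P) : ExMod K P n y x := emono K P n y x 0 0

/-- The `ℤⁿ`-degree of the monomial of `*E_x` with index `p`. -/
def gdeg (x : P) (p : EIdx P n y x) : Fin n → ℤ := fun i =>
  (if h : y i ≤ x then p.1 ⟨i, h⟩ else 0) +
    p.2.sum fun w c => c * (if y i ≤ w.1 then 1 else 0)

/-- The degree `aa` homogeneous component of `*E_x`. -/
def ExGrade (x : P) (aa : Fin n → ℤ) : Submodule K (ExMod K P n y x) :=
  Submodule.span K
    {e | ∃ p : EIdx P n y x, gdeg P n y x p = aa ∧
      e = Submodule.Quotient.mk (AddMonoidAlgebra.single p 1)}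

/-- `L(*E_x)`: the span of the basis monomials with nontrivial second factor and
componentwise nonnegative `ℤⁿ`-degree. -/
def cleanL (x : P) : Submodule K (ExMod K P n y x) :=
  Submodule.span K
    {e | ∃ a b, b ≠ 0 ∧ (∀ i, 0 ≤ gdeg P n y x (mIdx P n y x a b) i) ∧
      e = emono K P n y x a b}

/-- Degree preserving homomorphisms `*E_x → *E_z` (elements of `[*Hom(E_x, E_z)]_0`). -/
def DegZero (x z : P) (φ : ExMod K P n y x →ₗ[FaceS K P] ExMod K P n y z) : Prop :=
  ∀ aa, ∀ e ∈ ExGrade K P n y x aa, φ e ∈ ExGrade K P n y z aa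

/-- Clean homomorphisms `*E_x → *E_z`. -/
def IsClean (x z : P) (φ : ExMod K P n y x →ₗ[FaceS K P] ExMod K P n y z) : Prop :=
  DegZero K P n y x z φ ∧ ∀ e ∈ cleanL K P n y x, φ e ∈ cleanL K P n y z


section

set_option linter.unusedSectionVars false

variable {K P n y}

/-- A `K`-subspace stable under the variables is stable under the polynomial ring. -/
lemma smul_mem_of_X_smul_mem {M : Type*} [AddCommGroup M] [Module K M] [Module (FaceS K P) M]
    [IsScalarTower K (FaceS K P) M] (N : Submodule K M)
    (h : ∀ w : Pstar P, ∀ m ∈ N, (X w : FaceS K P) • m ∈ N) (s : FaceS K P) {m : M}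
    (hm : m ∈ N) : s • m ∈ N := by
  induction s using MvPolynomial.induction_on generalizing m with
  | C a =>
    rw [← MvPolynomial.algebraMap_eq, algebraMap_smul]
    exact N.smul_mem a hm
  | add p q hp hq => rw [add_smul]; exact N.add_mem (hp hm) (hq hm)
  | mul_X p w hp => rw [mul_smul]; exact hp (h w m hm)

/-- A `K`-linear map commuting with the variables is linear over the polynomial ring. -/
lemma map_smul_of_map_X_smul {M N : Type*} [AddCommGroup M] [Module K M] [Module (FaceS K P) M]
    [IsScalarTower K (FaceS K P) M] [AddCommGroup N] [Module K N] [Module (FaceS K P) N]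
    [IsScalarTower K (FaceS K P) N] (f : M →ₗ[K] N)
    (h : ∀ (w : Pstar P) (m : M), f ((X w : FaceS K P) • m) = (X w : FaceS K P) • f m)
    (s : FaceS K P) (m : M) : f (s • m) = s • f m := by
  induction s using MvPolynomial.induction_on generalizing m with
  | C a => rw [← MvPolynomial.algebraMap_eq, algebraMap_smul, algebraMap_smul, map_smul]
  | add p q hp hq => rw [add_smul, add_smul, map_add, hp, hq]
  | mul_X p w hp => rw [mul_smul, mul_smul, hp, h]

lemma X_smul_eq (x : P) (w : Pstar P) (g : Gx K P n y x) :
    (X w : FaceS K P) • g =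
      ((if w.1 ≤ x then AddMonoidAlgebra.single (dvec P n y x w.1, 0) 1 else 0) +
      (if h : ∃ i : Fin n, y i ≤ x ∧ y i = w.1 then 0
       else AddMonoidAlgebra.single
         ((0 : BelowIx P n y x →₀ ℤ), Finsupp.single (⟨w.1, w.2, h⟩ : Pmx P n y x) (1 : ℤ)) 1)) *
      g := by
  change theta K P n y x (X w) * g = _
  rw [theta, aeval_X]

lemma coeff_X_smul (x : P) (w : Pstar P) (g : Gx K P n y x) (p : EIdx P n y x) :
    ((X w : FaceS K P) • g).coeff p =
      (if w.1 ≤ x then g.coeff (p - (dvec P n y x w.1, 0)) else 0) +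
      (if h : ∃ i : Fin n, y i ≤ x ∧ y i = w.1 then 0
       else g.coeff (p - (0, Finsupp.single (⟨w.1, w.2, h⟩ : Pmx P n y x) (1 : ℤ)))) := by
  rw [X_smul_eq, add_mul]
  split_ifs <;> simp [sub_eq_neg_add]

lemma mIdx_sub_left (x : P) (a d : BelowIx P n y x →₀ ℤ) (b : Pmx P n y x →₀ ℕ) :
    mIdx P n y x a b - (d, 0) = mIdx P n y x (a - d) b := by
  simp [mIdx]

lemma mIdx_sub_right (x : P) (a : BelowIx P n y x →₀ ℤ) (b : Pmx P n y x →₀ ℕ)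
    (w : Pmx P n y x) :
    mIdx P n y x a b - (0, Finsupp.single w 1) = mIdx P n y x a (b + Finsupp.single w 1) := by
  refine Prod.ext (by simp [mIdx]) (Finsupp.ext fun v => ?_)
  simp only [mIdx, Prod.snd_sub, Finsupp.sub_apply, Finsupp.neg_apply, Finsupp.mapRange_apply,
    Finsupp.add_apply, Finsupp.single_apply]
  split_ifs <;> (simp; try ring)

lemma mIdx_injective {x : P} {a a' : BelowIx P n y x →₀ ℤ} {b b' : Pmx P n y x →₀ ℕ}
    (h : mIdx P n y x a b = mIdx P n y x a' b') : a = a' ∧ b = b' := by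
  refine ⟨congrArg Prod.fst h, Finsupp.ext fun v => ?_⟩
  have := DFunLike.congr_fun (congrArg Prod.snd h) v
  simpa [mIdx] using this

lemma exists_mIdx_eq {x : P} {p : EIdx P n y x} (hp : ¬ ∃ w, 0 < p.2 w) :
    ∃ b, p = mIdx P n y x p.1 b := by
  push Not at hp
  refine ⟨p.2.mapRange (fun c => (-c).toNat) (by simp), Prod.ext rfl (Finsupp.ext fun v => ?_)⟩
  have := hp v
  simp only [mIdx, Finsupp.neg_apply, Finsupp.mapRange_apply]
  omega

lemma coeff_mIdx_of_mem_Ux {x : P} {g : Gx K P n y x} (hg : g ∈ Ux K P n y x)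
    (a : BelowIx P n y x →₀ ℤ) (b : Pmx P n y x →₀ ℕ) : g.coeff (mIdx P n y x a b) = 0 := by
  let N : Submodule K (Gx K P n y x) :=
    { carrier := {g | ∀ a b, g.coeff (mIdx P n y x a b) = 0}
      add_mem' := fun hg hg' a b => by simp [hg a b, hg' a b]
      zero_mem' := fun a b => by simp
      smul_mem' := fun c g hg a b => by simp [hg a b] }
  suffices g ∈ N from this a b
  refine Submodule.span_induction (p := fun g _ => g ∈ N) ?_ N.zero_mem
    (fun _ _ _ _ h h' => N.add_mem h h') (fun s m _ hm => ?_) hg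
  · rintro _ ⟨p, ⟨w, hw⟩, rfl⟩ a b
    rw [AddMonoidAlgebra.coeff_single, Finsupp.single_apply, if_neg]
    rintro rfl
    simp only [mIdx, Finsupp.neg_apply, Finsupp.mapRange_apply] at hw
    omega
  · refine smul_mem_of_X_smul_mem N (fun w m hm a b => ?_) s hm
    rw [coeff_X_smul]
    simp only [mIdx_sub_left, mIdx_sub_right]
    split_ifs <;> simp [hm _ _]

variable (K P n y) in
/-- The coefficient of the monomial `∏ t_i^{a_i} ⊗ ∏ t_z^{-b_z}` as a functional on `*E_x`. -/
def exCoeff (x : P) (a : BelowIx P n y x →₀ ℤ) (b : Pmx P n y x →₀ ℕ) :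
    ExMod K P n y x →ₗ[K] K :=
  ((Ux K P n y x).restrictScalars K).liftQ
      { toFun := fun g => g.coeff (mIdx P n y x a b)
        map_add' := fun _ _ => by simp
        map_smul' := fun _ _ => by simp }
      (fun _ hg => coeff_mIdx_of_mem_Ux hg a b) ∘ₗ
    (Submodule.Quotient.restrictScalarsEquiv K (Ux K P n y x)).symm.toLinearMap

lemma exCoeff_mk (x : P) (a : BelowIx P n y x →₀ ℤ) (b : Pmx P n y x →₀ ℕ)
    (g : Gx K P n y x) :
    exCoeff K P n y x a b (Submodule.Quotient.mk g) = g.coeff (mIdx P n y x a b) := rfl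

lemma exCoeff_emono (x : P) (a a' : BelowIx P n y x →₀ ℤ) (b b' : Pmx P n y x →₀ ℕ) :
    exCoeff K P n y x a b (emono K P n y x a' b') = if a' = a ∧ b' = b then 1 else 0 := by
  rw [emono, exCoeff_mk, AddMonoidAlgebra.coeff_single, Finsupp.single_apply]
  refine if_congr ⟨mIdx_injective, ?_⟩ rfl rfl
  rintro ⟨rfl, rfl⟩
  rfl

lemma exCoeff_X_smul (x : P) (w : Pstar P) (a : BelowIx P n y x →₀ ℤ) (b : Pmx P n y x →₀ ℕ)
    (e : ExMod K P n y x) :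
    exCoeff K P n y x a b ((X w : FaceS K P) • e) =
      (if w.1 ≤ x then exCoeff K P n y x (a - dvec P n y x w.1) b e else 0) +
      (if h : ∃ i : Fin n, y i ≤ x ∧ y i = w.1 then 0
       else exCoeff K P n y x a (b + Finsupp.single (⟨w.1, w.2, h⟩ : Pmx P n y x) 1) e) := by
  obtain ⟨g, rfl⟩ := Submodule.Quotient.mk_surjective _ e
  rw [← Submodule.Quotient.mk_smul, exCoeff_mk, coeff_X_smul]
  simp only [mIdx_sub_left, mIdx_sub_right, exCoeff_mk]

lemma mk_single_eq_zero {x : P} {p : EIdx P n y x} (hp : ∃ w, 0 < p.2 w) :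
    (Submodule.Quotient.mk (AddMonoidAlgebra.single p 1) : ExMod K P n y x) = 0 :=
  (Submodule.Quotient.mk_eq_zero _).2 (Submodule.subset_span ⟨p, hp, rfl⟩)

/-- Every element of `*E_x` is a combination of the monomials with nonzero coefficient. -/
lemma mem_span_emono (x : P) (e : ExMod K P n y x) :
    e ∈ Submodule.span K {f | ∃ a b, exCoeff K P n y x a b e ≠ 0 ∧ f = emono K P n y x a b} := by
  obtain ⟨g, rfl⟩ := Submodule.Quotient.mk_surjective _ e
  have hg : (Submodule.Quotient.mk g : ExMod K P n y x) = ∑ p ∈ g.coeff.support,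
      g.coeff p • (Submodule.Quotient.mk (AddMonoidAlgebra.single p 1) : ExMod K P n y x) := by
    conv_lhs => rw [← AddMonoidAlgebra.sum_coeff_single g, Finsupp.sum]
    change (Ux K P n y x).mkQ _ = _
    rw [map_sum]
    refine Finset.sum_congr rfl fun p _ => ?_
    rw [← Submodule.Quotient.mk_smul]
    simp
  conv => arg 2; rw [hg]
  refine Submodule.sum_mem _ fun p hp => Submodule.smul_mem _ _ ?_
  by_cases h : ∃ w, 0 < p.2 w
  · rw [mk_single_eq_zero h]
    exact Submodule.zero_mem _
  · obtain ⟨b, hb⟩ := exists_mIdx_eq h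
    refine Submodule.subset_span ⟨p.1, b, ?_, ?_⟩
    · rw [exCoeff_mk, ← hb]
      exact Finsupp.mem_support_iff.1 hp
    · rw [emono, ← hb]

lemma eq_zero_of_exCoeff_eq_zero {x : P} {e : ExMod K P n y x}
    (h : ∀ a b, exCoeff K P n y x a b e = 0) : e = 0 := by
  have := mem_span_emono x e
  simpa [h] using this

lemma exCoeff_ext {x : P} {e f : ExMod K P n y x}
    (h : ∀ a b, exCoeff K P n y x a b e = exCoeff K P n y x a b f) : e = f :=
  sub_eq_zero.1 (eq_zero_of_exCoeff_eq_zero fun a b => by rw [map_sub, h, sub_self])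

lemma exCoeff_eq_zero_of_mem_ExGrade {x : P} {d : Fin n → ℤ} {e : ExMod K P n y x}
    (he : e ∈ ExGrade K P n y x d) {a : BelowIx P n y x →₀ ℤ} {b : Pmx P n y x →₀ ℕ}
    (hd : gdeg P n y x (mIdx P n y x a b) ≠ d) : exCoeff K P n y x a b e = 0 := by
  refine (Submodule.span_le (p := LinearMap.ker (exCoeff K P n y x a b))).2 ?_ he
  rintro _ ⟨p, hp, rfl⟩
  rw [SetLike.mem_coe, LinearMap.mem_ker, exCoeff_mk, AddMonoidAlgebra.coeff_single, Finsupp.single_apply, if_neg]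
  rintro rfl
  exact hd hp

lemma exCoeff_zero_of_mem_cleanL {x : P} {e : ExMod K P n y x} (he : e ∈ cleanL K P n y x)
    (a : BelowIx P n y x →₀ ℤ) : exCoeff K P n y x a 0 e = 0 := by
  refine (Submodule.span_le (p := LinearMap.ker (exCoeff K P n y x a 0))).2 ?_ he
  rintro _ ⟨a', b, hb, -, rfl⟩
  rw [SetLike.mem_coe, LinearMap.mem_ker, exCoeff_emono, if_neg fun h => hb h.2]

lemma dvec_atom (hy : AtomEnum P n y) (x : P) (i : BelowIx P n y x) :
    dvec P n y x (y i.1) = Finsupp.single i 1 := by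
  ext j
  simp only [dvec, Finsupp.equivFunOnFinite_symm_apply_apply, Finsupp.single_apply]
  refine if_congr ⟨fun h => ?_, fun h => h ▸ le_rfl⟩ rfl rfl
  have hi : IsAtom (y i.1) := (hy.2 _).2 ⟨_, rfl⟩
  have hj : IsAtom (y j.1) := (hy.2 _).2 ⟨_, rfl⟩
  exact Subtype.ext (hy.1 ((hi.le_iff_eq hj.1).1 h)).symm

lemma exCoeff_X_atom_smul (hy : AtomEnum P n y) (x : P) (i : BelowIx P n y x)
    (h0 : y i.1 ≠ ⊥) (a : BelowIx P n y x →₀ ℤ) (b : Pmx P n y x →₀ ℕ)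
    (e : ExMod K P n y x) :
    exCoeff K P n y x a b ((X ⟨y i.1, h0⟩ : FaceS K P) • e) =
      exCoeff K P n y x (a - Finsupp.single i 1) b e := by
  rw [exCoeff_X_smul, if_pos i.2, dif_pos ⟨i.1, i.2, rfl⟩, add_zero, dvec_atom hy]

lemma X_atom_smul_surjective (x : P) (i : Fin n) (hi : y i ≤ x) (h0 : y i ≠ ⊥)
    (e : ExMod K P n y x) : ∃ f : ExMod K P n y x, (X ⟨y i, h0⟩ : FaceS K P) • f = e := by
  obtain ⟨g, rfl⟩ := Submodule.Quotient.mk_surjective _ e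
  refine ⟨Submodule.Quotient.mk (AddMonoidAlgebra.single (-dvec P n y x (y i), 0) 1 * g), ?_⟩
  rw [← Submodule.Quotient.mk_smul, X_smul_eq, if_pos hi, dif_pos ⟨i, hi, rfl⟩, add_zero,
    ← mul_assoc, AddMonoidAlgebra.single_mul_single]
  simp [← Prod.zero_eq_mk, ← AddMonoidAlgebra.one_def]

/-- A homomorphism `*E_x → *E_z` is determined by the coefficients of `1_z` in its values. -/
lemma eq_zero_of_exCoeff_zero_zero (hy : AtomEnum P n y) {x z : P} (hzx : z ≤ x)
    (φ : ExMod K P n y x →ₗ[FaceS K P] ExMod K P n y z)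
    (h : ∀ e, exCoeff K P n y z 0 0 (φ e) = 0) : φ = 0 := by
  have hshift : ∀ (a : BelowIx P n y z →₀ ℤ) (i : BelowIx P n y z),
      (∀ e, exCoeff K P n y z (a - Finsupp.single i 1) 0 (φ e) = 0) ↔
        ∀ e, exCoeff K P n y z a 0 (φ e) = 0 := by
    intro a i
    have h0 : y i.1 ≠ ⊥ := ((hy.2 _).2 ⟨_, rfl⟩ : IsAtom _).1
    refine ⟨fun H e => ?_, fun H e => ?_⟩
    · obtain ⟨f, rfl⟩ := X_atom_smul_surjective x i.1 (i.2.trans hzx) h0 e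
      rw [map_smul, exCoeff_X_atom_smul hy z i, H]
    · rw [← exCoeff_X_atom_smul hy z i h0, ← map_smul, H]
  have hadd : ∀ (i : BelowIx P n y z) (k : ℤ) (a : BelowIx P n y z →₀ ℤ),
      (∀ e, exCoeff K P n y z a 0 (φ e) = 0) →
        ∀ e, exCoeff K P n y z (Finsupp.single i k + a) 0 (φ e) = 0 := by
    intro i k a ha
    induction k using Int.induction_on with
    | zero => simpa using ha
    | succ k hk =>
      rw [← hshift _ i]
      convert hk using 4
      rw [Finsupp.single_add]
      abel
    | pred k hk =>
      rw [← hshift _ i] at hk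
      convert hk using 4
      rw [Finsupp.single_sub]
      abel
  have hleft : ∀ (a : BelowIx P n y z →₀ ℤ) e, exCoeff K P n y z a 0 (φ e) = 0 := by
    intro a
    induction a using Finsupp.induction with
    | zero => exact h
    | single_add i k a _ _ ih => exact hadd i k a ih
  have hstep : ∀ (c : Pmx P n y z →₀ ℕ) (w : Pmx P n y z),
      (∀ a e, exCoeff K P n y z a c (φ e) = 0) →
        ∀ a e, exCoeff K P n y z a (c + Finsupp.single w 1) (φ e) = 0 := by
    intro c w hc a e
    have := exCoeff_X_smul z ⟨w.1, w.2.1⟩ a c (φ e)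
    rw [← map_smul, hc, dif_neg w.2.2, hc, ite_self, zero_add] at this
    exact this.symm
  have hadd' : ∀ (w : Pmx P n y z) (k : ℕ) (c : Pmx P n y z →₀ ℕ),
      (∀ a e, exCoeff K P n y z a c (φ e) = 0) →
        ∀ a e, exCoeff K P n y z a (Finsupp.single w k + c) (φ e) = 0 := by
    intro w k c hc
    induction k with
    | zero => simpa using hc
    | succ k hk =>
      rw [Finsupp.single_add, add_right_comm]
      exact hstep _ w hk
  have hall : ∀ (c : Pmx P n y z →₀ ℕ) a e, exCoeff K P n y z a c (φ e) = 0 := by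
    intro c
    induction c using Finsupp.induction with
    | zero => exact hleft
    | single_add w k c _ _ ih => exact hadd' w k c ih
  exact LinearMap.ext fun e => eq_zero_of_exCoeff_eq_zero fun a c => hall c a e

lemma gdeg_add (x : P) (p q : EIdx P n y x) :
    gdeg P n y x (p + q) = gdeg P n y x p + gdeg P n y x q := by
  ext i
  simp only [gdeg, Pi.add_apply, Prod.fst_add, Prod.snd_add, Finsupp.add_apply]
  rw [Finsupp.sum_add_index' (by simp) (by intros; ring)]
  split_ifs <;> ring

lemma gdeg_zero (x : P) : gdeg P n y x 0 = 0 := by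
  simpa using gdeg_add (n := n) (y := y) x 0 0

lemma gdeg_neg (x : P) (p : EIdx P n y x) : gdeg P n y x (-p) = -gdeg P n y x p := by
  rw [eq_neg_iff_add_eq_zero, ← gdeg_add, neg_add_cancel, gdeg_zero]

lemma gdeg_mIdx (x : P) (a : BelowIx P n y x →₀ ℤ) (b : Pmx P n y x →₀ ℕ) (i : Fin n) :
    gdeg P n y x (mIdx P n y x a b) i =
      (if h : y i ≤ x then a ⟨i, h⟩ else 0) - ∑ w, (b w : ℤ) * if y i ≤ w.1 then 1 else 0 := by
  simp only [gdeg, mIdx]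
  rw [Finsupp.sum_fintype _ _ (by simp), sub_eq_add_neg, ← Finset.sum_neg_distrib]
  simp only [Finsupp.neg_apply, Finsupp.mapRange_apply, neg_mul]

/-- A clean map is determined by the coefficient of `1_z` in the image of `1_x`. -/
lemma IsClean.eq_zero (hy : AtomEnum P n y) {x z : P} (hzx : z ≤ x)
    {φ : ExMod K P n y x →ₗ[FaceS K P] ExMod K P n y z} (hφ : IsClean K P n y x z φ)
    (h1 : exCoeff K P n y z 0 0 (φ (onex K P n y x)) = 0) : φ = 0 := by
  refine eq_zero_of_exCoeff_zero_zero hy hzx φ fun e => ?_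
  have hm0 : gdeg P n y z (mIdx P n y z 0 0) = 0 := by
    ext i
    simp [gdeg_mIdx]
  have key : ∀ a b, exCoeff K P n y z 0 0 (φ (emono K P n y x a b)) = 0 := by
    intro a b
    by_cases hd : gdeg P n y x (mIdx P n y x a b) = 0
    · by_cases hb : b = 0
      · have ha : a = 0 := by
          ext i
          have := congrFun hd i.1
          rw [gdeg_mIdx] at this
          simpa [hb, i.2] using this
        rw [ha, hb]
        exact h1
      · exact exCoeff_zero_of_mem_cleanL
          (hφ.2 _ (Submodule.subset_span ⟨a, b, hb, fun i => by simp [hd], rfl⟩)) 0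
    · exact exCoeff_eq_zero_of_mem_ExGrade
        (hφ.1 _ _ (Submodule.subset_span ⟨mIdx P n y x a b, rfl, rfl⟩))
        (fun h => hd (h.symm.trans hm0))
  have he : e ∈ LinearMap.ker (exCoeff K P n y z 0 0 ∘ₗ φ.restrictScalars K) := by
    refine Submodule.span_le.2 ?_ (mem_span_emono x e)
    rintro _ ⟨a, b, -, rfl⟩
    exact key a b
  exact he

/-- In a simplicial poset, elements below `x` are ordered by the atoms below them. -/
lemma IsSimplicialPoset.le_of_forall_atom (hP : IsSimplicialPoset P) (hy : AtomEnum P n y)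
    {x w z : P} (hw : w ≤ x) (hz : z ≤ x) (h : ∀ i, y i ≤ w → y i ≤ z) : w ≤ z := by
  obtain ⟨m, ⟨e⟩⟩ := hP x
  suffices e ⟨w, hw⟩ ≤ e ⟨z, hz⟩ from e.le_iff_le.1 this
  intro j hj
  have hu : IsAtom (e.symm {j}) := (e.symm.isAtom_iff _).2 (Finset.isAtom_singleton j)
  obtain ⟨i, hi⟩ := (hy.2 _).1 hu.of_isAtom_coe_Iic
  have h1 : e.symm {j} ≤ ⟨w, hw⟩ :=
    e.symm_apply_le.2 (Finset.singleton_subset_iff.2 hj)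
  have h2 : e.symm {j} ≤ ⟨z, hz⟩ := by
    have := h i (hi ▸ h1)
    rw [hi] at this
    exact this
  exact Finset.singleton_subset_iff.1 (e.symm_apply_le.1 h2)

variable (P n y) in
/-- Extension by zero of exponent vectors from the atoms below `z` to the atoms below `x`. -/
def extExp (x z : P) (a : BelowIx P n y z →₀ ℤ) : BelowIx P n y x →₀ ℤ :=
  Finsupp.equivFunOnFinite.symm fun i => if h : y i.1 ≤ z then a ⟨i.1, h⟩ else 0

lemma extExp_apply (x z : P) (a : BelowIx P n y z →₀ ℤ) (i : BelowIx P n y x) :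
    extExp P n y x z a i = if h : y i.1 ≤ z then a ⟨i.1, h⟩ else 0 := rfl

lemma extExp_add (x z : P) (a a' : BelowIx P n y z →₀ ℤ) :
    extExp P n y x z (a + a') = extExp P n y x z a + extExp P n y x z a' := by
  ext i
  simp only [extExp_apply, Finsupp.add_apply]
  split_ifs <;> simp

lemma extExp_zero (x z : P) : extExp P n y x z 0 = 0 := by
  ext i
  simp [extExp_apply]

lemma extExp_dvec (x : P) {z w : P} (hw : w ≤ z) :
    extExp P n y x z (dvec P n y z w) = dvec P n y x w := by
  ext i
  simp only [extExp_apply, dvec, Finsupp.equivFunOnFinite_symm_apply_apply]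
  split_ifs with h1 h2 h2 <;> first | rfl | exact absurd (h2.trans hw) h1

variable (K P n y) in
/-- The action on `*E_x` of the transformed variable `t̃_w` relative to `z`. -/
def shiftVar (x z : P) (w : Pmx P n y z) : Gx K P n y x :=
  (if w.1 ≤ x ∧ ¬ w.1 ≤ z then AddMonoidAlgebra.single (dvec P n y x w.1, 0) 1 else 0) +
  (if h : ∃ i : Fin n, y i ≤ x ∧ y i = w.1 then 0
    else AddMonoidAlgebra.single
      ((0 : BelowIx P n y x →₀ ℤ), Finsupp.single (⟨w.1, w.2.1, h⟩ : Pmx P n y x) (1 : ℤ)) 1)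

lemma X_smul_eq_shiftVar {x z : P} (hzx : z ≤ x) (w : Pstar P) (g : Gx K P n y x) :
    (X w : FaceS K P) • g =
      ((if w.1 ≤ z then
          AddMonoidAlgebra.single (extExp P n y x z (dvec P n y z w.1), 0) 1 else 0) +
      (if h : ∃ i : Fin n, y i ≤ z ∧ y i = w.1 then 0
       else shiftVar K P n y x z ⟨w.1, w.2, h⟩)) * g := by
  rw [X_smul_eq]
  congr 1
  by_cases hwz : w.1 ≤ z
  · rw [if_pos hwz, if_pos (hwz.trans hzx), extExp_dvec x hwz]
    congr 1
    by_cases h : ∃ i : Fin n, y i ≤ z ∧ y i = w.1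
    · have h' : ∃ i : Fin n, y i ≤ x ∧ y i = w.1 := h.imp fun i hi => ⟨hi.1.trans hzx, hi.2⟩
      rw [dif_pos h, dif_pos h']
    · rw [dif_neg h, shiftVar, if_neg (by simp [hwz]), zero_add]
  · have h : ¬ ∃ i : Fin n, y i ≤ z ∧ y i = w.1 := by
      rintro ⟨i, hi, hi'⟩
      exact hwz (hi' ▸ hi)
    rw [if_neg hwz, dif_neg h, shiftVar, zero_add]
    simp only [hwz, not_false_eq_true, and_true]

variable (K P n y) in
/-- The action on `*E_x` of `∏ t_i^{a_i} ∏ t̃_w^{c_w}`, relative to `z`. -/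
def shiftMono (x z : P) (a : BelowIx P n y z →₀ ℤ) (c : Pmx P n y z →₀ ℕ) : Gx K P n y x :=
  AddMonoidAlgebra.single (extExp P n y x z a, 0) 1 *
    c.prod fun w k => shiftVar K P n y x z w ^ k

lemma shiftMono_add_left (x z : P) (a a' : BelowIx P n y z →₀ ℤ) (c : Pmx P n y z →₀ ℕ) :
    shiftMono K P n y x z (a + a') c =
      shiftMono K P n y x z a c * AddMonoidAlgebra.single (extExp P n y x z a', 0) 1 := by
  rw [shiftMono, shiftMono, mul_right_comm, AddMonoidAlgebra.single_mul_single, extExp_add]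
  simp

lemma shiftMono_add_single (x z : P) (a : BelowIx P n y z →₀ ℤ) (c : Pmx P n y z →₀ ℕ)
    (w : Pmx P n y z) :
    shiftMono K P n y x z a (c + Finsupp.single w 1) =
      shiftMono K P n y x z a c * shiftVar K P n y x z w := by
  rw [shiftMono, shiftMono, Finsupp.prod_add_index' (by simp) (by intros; rw [pow_add]),
    Finsupp.prod_single_index (by simp), pow_one, mul_assoc]

lemma exists_of_coeff_mul_ne_zero {G : Type*} [Add G] {g h : AddMonoidAlgebra K G} {p : G}
    (H : (g * h).coeff p ≠ 0) : ∃ q r, g.coeff q ≠ 0 ∧ h.coeff r ≠ 0 ∧ q + r = p := by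
  have := AddMonoidAlgebra.support_coeff_mul_subset g h (Finsupp.mem_support_iff.2 H)
  obtain ⟨q, hq, r, hr, rfl⟩ := Finset.mem_add.1 this
  exact ⟨q, r, Finsupp.mem_support_iff.1 hq, Finsupp.mem_support_iff.1 hr, rfl⟩

lemma mIdx_zero_add (x : P) (b b' : Pmx P n y x →₀ ℕ) :
    mIdx P n y x 0 (b + b') = mIdx P n y x 0 b + mIdx P n y x 0 b' := by
  refine Prod.ext (by simp [mIdx]) (Finsupp.ext fun v => ?_)
  simp only [mIdx, Prod.snd_add, Finsupp.add_apply, Finsupp.neg_apply, Finsupp.mapRange_apply]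
  push_cast
  ring

lemma gdeg_dvec {x w : P} (hw : w ≤ x) (i : Fin n) :
    gdeg P n y x (dvec P n y x w, 0) i = if y i ≤ w then 1 else 0 := by
  simp only [gdeg, dvec, Finsupp.equivFunOnFinite_symm_apply_apply, Finsupp.sum_zero_index,
    add_zero]
  split_ifs with h1 h2 h2 <;> first | rfl | exact absurd (h2.trans hw) h1

lemma gdeg_single (x : P) (w : Pmx P n y x) (i : Fin n) :
    gdeg P n y x (0, Finsupp.single w 1) i = if y i ≤ w.1 then 1 else 0 := by
  simp [gdeg]

lemma gdeg_mIdx_single (z : P) (w : Pmx P n y z) :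
    gdeg P n y z (mIdx P n y z 0 (Finsupp.single w 1)) =
      -gdeg P n y z (0, Finsupp.single w 1) := by
  rw [← gdeg_neg]
  congr 1
  refine Prod.ext (by simp [mIdx]) ?_
  simp [mIdx]

lemma coeff_shiftVar_ne_zero {x z : P} {w : Pmx P n y z} {p : EIdx P n y x}
    (h : (shiftVar K P n y x z w).coeff p ≠ 0) :
    (∀ v, 0 ≤ p.2 v) ∧
      gdeg P n y x p = -gdeg P n y z (mIdx P n y z 0 (Finsupp.single w 1)) ∧
      ∀ v : Pmx P n y x, v.1 = w.1 → ¬ (w.1 ≤ x ∧ ¬ w.1 ≤ z) → 1 ≤ p.2 v := by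
  rw [gdeg_mIdx_single, neg_neg]
  rw [shiftVar, AddMonoidAlgebra.coeff_add, Finsupp.add_apply] at h
  by_cases h1 : (if w.1 ≤ x ∧ ¬ w.1 ≤ z then
      (AddMonoidAlgebra.single (dvec P n y x w.1, 0) 1 : Gx K P n y x) else 0).coeff p = 0
  · rw [h1, zero_add] at h
    split_ifs at h with h2
    · simp at h
    · rw [AddMonoidAlgebra.coeff_single, Finsupp.single_apply] at h
      obtain rfl : _ = p := by
        by_contra hne
        exact h (if_neg hne)
      refine ⟨fun v => ?_, ?_, fun v hv _ => ?_⟩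
      · simp only [Finsupp.single_apply]
        split_ifs <;> simp
      · ext i
        rw [gdeg_single, gdeg_single]
      · obtain rfl : v = ⟨w.1, w.2.1, h2⟩ := Subtype.ext hv
        simp
  · split_ifs at h1 with h2
    · rw [AddMonoidAlgebra.coeff_single, Finsupp.single_apply] at h1
      obtain rfl : _ = p := by
        by_contra hne
        exact h1 (if_neg hne)
      refine ⟨fun v => by simp, ?_, fun v _ h3 => absurd h2 h3⟩
      ext i
      rw [gdeg_dvec h2.1, gdeg_single]
    · simp at h1

lemma coeff_prod_shiftVar_ne_zero {x z : P} (c : Pmx P n y z →₀ ℕ) {p : EIdx P n y x}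
    (h : (c.prod fun w k => shiftVar K P n y x z w ^ k).coeff p ≠ 0) :
    (∀ v, 0 ≤ p.2 v) ∧ gdeg P n y x p = -gdeg P n y z (mIdx P n y z 0 c) ∧
      ∀ (w : Pmx P n y z) (v : Pmx P n y x), v.1 = w.1 → ¬ (w.1 ≤ x ∧ ¬ w.1 ≤ z) →
        (c w : ℤ) ≤ p.2 v := by
  have hm0 : mIdx P n y z 0 0 = 0 := Prod.ext rfl (by simp [mIdx])
  have hzero : ∀ {p : EIdx P n y x}, ((0 : Pmx P n y z →₀ ℕ).prod
      fun w k => shiftVar K P n y x z w ^ k).coeff p ≠ 0 → p = 0 := by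
    intro p h
    rw [Finsupp.prod_zero_index, AddMonoidAlgebra.one_def, AddMonoidAlgebra.coeff_single,
      Finsupp.single_apply] at h
    by_contra hne
    exact h (if_neg (Ne.symm hne))
  have hadd : ∀ c c' : Pmx P n y z →₀ ℕ, ((c + c').prod
      fun w k => shiftVar K P n y x z w ^ k) =
        (c.prod fun w k => shiftVar K P n y x z w ^ k) *
          c'.prod fun w k => shiftVar K P n y x z w ^ k := fun c c' =>
    Finsupp.prod_add_index' (by simp) (by intros; rw [pow_add])
  induction c using Finsupp.induction_linear generalizing p with
  | zero =>
    obtain rfl := hzero h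
    simp [hm0, gdeg_zero]
  | add c c' hc hc' =>
    rw [hadd] at h
    obtain ⟨q, r, hq, hr, rfl⟩ := exists_of_coeff_mul_ne_zero h
    obtain ⟨h1, h2, h3⟩ := hc hq
    obtain ⟨h1', h2', h3'⟩ := hc' hr
    refine ⟨fun v => add_nonneg (h1 v) (h1' v), ?_, fun w v hv hw => ?_⟩
    · rw [gdeg_add, h2, h2', mIdx_zero_add, gdeg_add, neg_add]
    · have := add_le_add (h3 w v hv hw) (h3' w v hv hw)
      simpa using this
  | single w k =>
    induction k generalizing p with
    | zero =>
      rw [Finsupp.single_zero] at h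
      obtain rfl := hzero h
      simp [hm0, gdeg_zero]
    | succ k hk =>
      rw [Finsupp.single_add, hadd] at h
      obtain ⟨q, r, hq, hr, rfl⟩ := exists_of_coeff_mul_ne_zero h
      rw [Finsupp.prod_single_index (by simp), pow_one] at hr
      obtain ⟨h1, h2, h3⟩ := hk hq
      obtain ⟨h1', h2', h3'⟩ := coeff_shiftVar_ne_zero hr
      refine ⟨fun v => add_nonneg (h1 v) (h1' v), ?_, fun w' v hv hw => ?_⟩
      · rw [gdeg_add, h2, h2', Finsupp.single_add, mIdx_zero_add, gdeg_add, neg_add]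
      · have h4 := h3 w' v hv hw
        rw [Finsupp.single_apply] at h4 ⊢
        have h5 := h1' v
        rw [Prod.snd_add, Finsupp.add_apply]
        split_ifs at h4 ⊢ with he
        · subst he
          have := h3' v hv hw
          push_cast
          omega
        · simp only [Nat.cast_zero] at h4 ⊢
          omega

variable (K P n y) in
/-- The functional `g ↦` the coefficient of `1_x` in `∏ t_i^{-a_i} ∏ t̃_w^{c_w} g`. -/
def shiftCoeff (x z : P) (a : BelowIx P n y z →₀ ℤ) (c : Pmx P n y z →₀ ℕ) :
    Gx K P n y x →ₗ[K] K where
  toFun g := (shiftMono K P n y x z (-a) c * g).coeff 0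
  map_add' _ _ := by simp [mul_add]
  map_smul' _ _ := by simp

lemma shiftCoeff_apply (x z : P) (a : BelowIx P n y z →₀ ℤ) (c : Pmx P n y z →₀ ℕ)
    (g : Gx K P n y x) :
    shiftCoeff K P n y x z a c g = (shiftMono K P n y x z (-a) c * g).coeff 0 := rfl

lemma shiftCoeff_X_smul {x z : P} (hzx : z ≤ x) (a : BelowIx P n y z →₀ ℤ)
    (c : Pmx P n y z →₀ ℕ) (w : Pstar P) (g : Gx K P n y x) :
    shiftCoeff K P n y x z a c ((X w : FaceS K P) • g) =
      (if w.1 ≤ z then shiftCoeff K P n y x z (a - dvec P n y z w.1) c g else 0) +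
      (if h : ∃ i : Fin n, y i ≤ z ∧ y i = w.1 then 0
       else shiftCoeff K P n y x z a (c + Finsupp.single (⟨w.1, w.2, h⟩ : Pmx P n y z) 1) g) := by
  rw [shiftCoeff_apply, X_smul_eq_shiftVar hzx, ← mul_assoc, mul_add, add_mul,
    AddMonoidAlgebra.coeff_add, Finsupp.add_apply]
  congr 1
  · split_ifs with h
    · rw [shiftCoeff_apply, neg_sub, sub_eq_neg_add, shiftMono_add_left]
    · simp
  · split_ifs with h
    · simp
    · rw [shiftCoeff_apply, shiftMono_add_single]

lemma shiftCoeff_single_ne_zero {x z : P} (hzx : z ≤ x) {a : BelowIx P n y z →₀ ℤ}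
    {c : Pmx P n y z →₀ ℕ} {q : EIdx P n y x}
    (h : shiftCoeff K P n y x z a c (AddMonoidAlgebra.single q 1) ≠ 0) :
    (∀ v, q.2 v ≤ 0) ∧ gdeg P n y z (mIdx P n y z a c) = gdeg P n y x q ∧
      ∀ (w : Pmx P n y z) (v : Pmx P n y x), v.1 = w.1 → ¬ (w.1 ≤ x ∧ ¬ w.1 ≤ z) →
        (c w : ℤ) ≤ -q.2 v := by
  rw [shiftCoeff_apply, shiftMono, mul_right_comm, AddMonoidAlgebra.single_mul_single,
    AddMonoidAlgebra.coeff_single_mul_apply, add_zero, one_mul, one_mul] at h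
  obtain ⟨h1, h2, h3⟩ := coeff_prod_shiftVar_ne_zero c h
  simp only [Prod.snd_neg, Prod.snd_add, zero_add, Finsupp.neg_apply] at h1 h3
  refine ⟨fun v => by have := h1 v; omega, ?_, h3⟩
  have hext : ∀ i, gdeg P n y x (extExp P n y x z (-a), 0) i = -gdeg P n y z (a, 0) i := by
    intro i
    simp only [gdeg, extExp_apply, Finsupp.sum_zero_index, add_zero, Finsupp.neg_apply]
    split_ifs with hx hz hz
    · rfl
    · simp
    · exact absurd (hz.trans hzx) hx
    · simp
  have hm : mIdx P n y z a c = (a, 0) + mIdx P n y z 0 c :=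
    Prod.ext (by simp [mIdx]) (by simp [mIdx])
  rw [gdeg_neg, gdeg_add, neg_inj] at h2
  rw [hm, gdeg_add, ← h2]
  ext i
  simp only [Pi.add_apply, hext]
  ring

lemma finite_shiftCoeff_single_ne_zero (hP : IsSimplicialPoset P) (hy : AtomEnum P n y)
    {x z : P} (hzx : z ≤ x) (q : EIdx P n y x) :
    {p : (BelowIx P n y z →₀ ℤ) × (Pmx P n y z →₀ ℕ) |
      shiftCoeff K P n y x z p.1 p.2 (AddMonoidAlgebra.single q 1) ≠ 0}.Finite := by
  let N : ℕ := ∑ i, (gdeg P n y x q i).natAbs + ∑ v, (q.2 v).natAbs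
  let B : Pmx P n y z →₀ ℕ := Finsupp.equivFunOnFinite.symm fun _ => N
  let A : (Pmx P n y z →₀ ℕ) → (BelowIx P n y z →₀ ℤ) := fun c =>
    Finsupp.equivFunOnFinite.symm fun i =>
      gdeg P n y x q i.1 - gdeg P n y z (mIdx P n y z 0 c) i.1
  refine ((Set.finite_Iic B).image fun c => (A c, c)).subset ?_
  rintro ⟨a, c⟩ (h : shiftCoeff K P n y x z a c _ ≠ 0)
  obtain ⟨-, h2, h3⟩ := shiftCoeff_single_ne_zero hzx h
  refine ⟨c, fun w => ?_, Prod.ext (Finsupp.ext fun i => ?_) rfl⟩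
  · change c w ≤ N
    by_cases hw : w.1 ≤ x ∧ ¬ w.1 ≤ z
    · obtain ⟨i, hiw, hiz⟩ : ∃ i, y i ≤ w.1 ∧ ¬ y i ≤ z := by
        by_contra! hcon
        exact hw.2 (hP.le_of_forall_atom hy hw.1 hzx hcon)
      have hd := congrFun h2 i
      rw [gdeg_mIdx, dif_neg hiz] at hd
      have hle : (c w : ℤ) * (if y i ≤ w.1 then 1 else 0) ≤
          ∑ w, (c w : ℤ) * if y i ≤ w.1 then 1 else 0 :=
        Finset.single_le_sum (f := fun w => (c w : ℤ) * if y i ≤ w.1 then 1 else 0)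
          (fun w _ => by positivity) (Finset.mem_univ w)
      rw [if_pos hiw] at hle
      have hN : (gdeg P n y x q i).natAbs ≤ ∑ i, (gdeg P n y x q i).natAbs :=
        Finset.single_le_sum (f := fun i => (gdeg P n y x q i).natAbs)
          (fun _ _ => Nat.zero_le _) (Finset.mem_univ i)
      omega
    · have hv : ¬ ∃ i, y i ≤ x ∧ y i = w.1 := by
        rintro ⟨i, hi, hi'⟩
        by_cases hz : w.1 ≤ z
        · exact w.2.2 ⟨i, hi' ▸ hz, hi'⟩
        · exact hw ⟨hi' ▸ hi, hz⟩
      have hle := h3 w ⟨w.1, w.2.1, hv⟩ rfl hw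
      have hN : (q.2 ⟨w.1, w.2.1, hv⟩).natAbs ≤ ∑ v, (q.2 v).natAbs :=
        Finset.single_le_sum (f := fun v => (q.2 v).natAbs)
          (fun _ _ => Nat.zero_le _) (Finset.mem_univ _)
      omega
  · change gdeg P n y x q i.1 - gdeg P n y z (mIdx P n y z 0 c) i.1 = a i
    rw [← h2, gdeg_mIdx, gdeg_mIdx, dif_pos i.2, dif_pos i.2]
    simp

lemma exists_exCoeff_eq_shiftCoeff (hP : IsSimplicialPoset P) (hy : AtomEnum P n y)
    {x z : P} (hzx : z ≤ x) (g : Gx K P n y x) :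
    ∃ e : ExMod K P n y z, ∀ a c,
      exCoeff K P n y z a c e = shiftCoeff K P n y x z a c g := by
  induction g using AddMonoidAlgebra.induction_linear with
  | zero => exact ⟨0, by simp⟩
  | add g g' hg hg' =>
    obtain ⟨e, he⟩ := hg
    obtain ⟨e', he'⟩ := hg'
    exact ⟨e + e', fun a c => by rw [map_add, map_add, he, he']⟩
  | single q r =>
    have hfin := finite_shiftCoeff_single_ne_zero (K := K) hP hy hzx q
    refine ⟨r • ∑ p ∈ hfin.toFinset,
      shiftCoeff K P n y x z p.1 p.2 (AddMonoidAlgebra.single q 1) •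
        emono K P n y z p.1 p.2, fun a c => ?_⟩
    have hr : (AddMonoidAlgebra.single q r : Gx K P n y x) =
        r • AddMonoidAlgebra.single q 1 := by simp
    rw [hr, map_smul, map_smul, map_sum, Finset.sum_eq_single (a, c)]
    · rw [map_smul, exCoeff_emono, if_pos ⟨rfl, rfl⟩, smul_eq_mul _ (1 : K), mul_one]
    · rintro ⟨a', c'⟩ - hne
      rw [map_smul, exCoeff_emono, if_neg, smul_zero]
      rintro ⟨rfl, rfl⟩
      exact hne rfl
    · intro hp
      rw [Set.Finite.mem_toFinset, Set.mem_ofPred_eq, not_not] at hp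
      rw [hp, zero_smul, map_zero]

lemma exists_linearMap_exCoeff_eq (hP : IsSimplicialPoset P) (hy : AtomEnum P n y)
    {x z : P} (hzx : z ≤ x) :
    ∃ ψ : ExMod K P n y x →ₗ[FaceS K P] ExMod K P n y z, ∀ g a c,
      exCoeff K P n y z a c (ψ (Submodule.Quotient.mk g)) =
        shiftCoeff K P n y x z a c g := by
  choose f hf using exists_exCoeff_eq_shiftCoeff (K := K) hP hy hzx
  let F : Gx K P n y x →ₗ[K] ExMod K P n y z :=
    { toFun := f
      map_add' := fun g g' => exCoeff_ext fun a c => by simp only [map_add, hf]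
      map_smul' := fun r g => exCoeff_ext fun a c => by simp only [map_smul, hf, RingHom.id_apply] }
  have hF : ∀ g a c, exCoeff K P n y z a c (F g) = shiftCoeff K P n y x z a c g := hf
  let F' : Gx K P n y x →ₗ[FaceS K P] ExMod K P n y z :=
    { toFun := F
      map_add' := map_add F
      map_smul' := map_smul_of_map_X_smul F fun w g => exCoeff_ext fun a c => by
        rw [hF, shiftCoeff_X_smul hzx, exCoeff_X_smul]
        simp only [hF] }
  refine ⟨(Ux K P n y x).liftQ F' (Submodule.span_le.2 ?_), fun g a c => hF g a c⟩
  rintro _ ⟨p, ⟨w, hw⟩, rfl⟩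
  refine exCoeff_ext fun a c => ?_
  rw [map_zero]
  refine (hF _ a c).trans ?_
  by_contra hne
  exact absurd ((shiftCoeff_single_ne_zero hzx hne).1 w) (not_le.2 hw)

/-- The map `*E_x → *E_z` induced by the coefficient functional of `1_x` is clean. -/
lemma isClean_of_exCoeff_eq {x z : P} (hzx : z ≤ x)
    {ψ : ExMod K P n y x →ₗ[FaceS K P] ExMod K P n y z}
    (hψ : ∀ g a c, exCoeff K P n y z a c (ψ (Submodule.Quotient.mk g)) =
      shiftCoeff K P n y x z a c g) : IsClean K P n y x z ψ := by
  refine ⟨fun d e he => ?_, fun e he => ?_⟩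
  · refine (Submodule.span_le
      (p := (ExGrade K P n y z d).comap (ψ.restrictScalars K))).2 ?_ he
    rintro _ ⟨q, hq, rfl⟩
    refine Submodule.span_mono ?_ (mem_span_emono z (ψ (Submodule.Quotient.mk _)))
    rintro _ ⟨a, c, hne, rfl⟩
    rw [hψ] at hne
    exact ⟨_, (shiftCoeff_single_ne_zero hzx hne).2.1.trans hq, rfl⟩
  · refine (Submodule.span_le
      (p := (cleanL K P n y z).comap (ψ.restrictScalars K))).2 ?_ he
    rintro _ ⟨a', b, hb, hd, rfl⟩
    refine Submodule.span_mono ?_ (mem_span_emono z (ψ (emono K P n y x a' b)))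
    rintro _ ⟨a, c, hne, rfl⟩
    rw [emono, hψ] at hne
    refine ⟨a, c, ?_, fun i => ?_, rfl⟩
    · rintro rfl
      rw [shiftCoeff_apply, shiftMono, Finsupp.prod_zero_index, mul_one,
        AddMonoidAlgebra.single_mul_single, AddMonoidAlgebra.coeff_single,
        Finsupp.single_apply] at hne
      refine hb (Finsupp.ext fun v => ?_)
      by_contra hv
      refine hne (if_neg fun h => hv ?_)
      have := DFunLike.congr_fun (congrArg Prod.snd h) v
      simpa [mIdx] using this
    · rw [(shiftCoeff_single_ne_zero hzx hne).2.1]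
      exact hd i

end

/-- Theorem 3.9: for `x ≥ z` there is a (nonzero) clean map
`*E_x → *E_z`, and it is unique up to multiplication by a scalar in `K`. -/
theorem statement15
    (hP : IsSimplicialPoset P) (hy : AtomEnum P n y)
    (x z : P) (hzx : z ≤ x) :
    ∃ ψ₀ : ExMod K P n y x →ₗ[FaceS K P] ExMod K P n y z,
      IsClean K P n y x z ψ₀ ∧ ψ₀ ≠ 0 ∧
      ∀ ψ : ExMod K P n y x →ₗ[FaceS K P] ExMod K P n y z,
        IsClean K P n y x z ψ → ∃ c : K, ψ = c • ψ₀ := by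
  obtain ⟨ψ₀, h₀⟩ := exists_linearMap_exCoeff_eq (K := K) hP hy hzx
  have hclean := isClean_of_exCoeff_eq hzx h₀
  have hone : exCoeff K P n y z 0 0 (ψ₀ (onex K P n y x)) = 1 := by
    have hm0 : mIdx P n y x 0 0 = 0 := Prod.ext rfl (by simp [mIdx])
    rw [onex, emono, h₀, shiftCoeff_apply, shiftMono, Finsupp.prod_zero_index, neg_zero,
      extExp_zero, hm0, ← Prod.zero_eq_mk, ← AddMonoidAlgebra.one_def]
    simp [AddMonoidAlgebra.one_def]
  refine ⟨ψ₀, hclean, ?_, fun ψ hψ =>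
    ⟨exCoeff K P n y z 0 0 (ψ (onex K P n y x)), sub_eq_zero.1 ?_⟩⟩
  · rintro rfl
    simp at hone
  · refine IsClean.eq_zero hy hzx ⟨fun d e he => ?_, fun e he => ?_⟩ ?_
    · exact Submodule.sub_mem _ (hψ.1 d e he) (Submodule.smul_mem _ _ (hclean.1 d e he))
    · exact Submodule.sub_mem _ (hψ.2 e he) (Submodule.smul_mem _ _ (hclean.2 e he))
    · rw [LinearMap.sub_apply, LinearMap.smul_apply, map_sub, map_smul, hone, smul_eq_mul,
        mul_one, sub_self]

end
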